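/- Let (R,m) be a Noetherian local ring, I an ideal, N a finitely generated R-module, and k ≥ -1 an integer. Let r = depth_k(I,N) < ∞ and let x_1,...,x_r be an N-sequence in dimension > k contained in I. Then for any integer l ≤ r, the set of primes p with dim(R/p) ≥ k in ⋃_{j≤l} Ass_R(H^j_I(N)) equals ⋃_{j≤l} { p ∈ Ass_R(N/(x_1,...,x_j)N) : dim(R/p) ≥ k and I ⊆ p }. -/

import Mathlib

open CategoryTheory Opposite IsLocalRing

/-- Interpretation of an integer `k ≥ -1` in `WithBot ℕ∞`, for comparison with Krull dimensions. -/
noncomputable def zdim (k : ℤ) : WithBot (WithTop ℕ) :=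
  if k < 0 then ⊥ else ((k.toNat : WithTop ℕ) : WithBot (WithTop ℕ))

/-- The ideal generated by the first `j` entries of the sequence `x`. -/
def prefIdeal {R : Type} [CommRing R] {r : ℕ} (x : Fin r → R) (j : ℕ) : Ideal R :=
  Ideal.span (x '' {i | (i : ℕ) < j})

/-- `x` is an `N`-sequence in dimension `> k`: for each `i`, `x i` avoids every associated
prime `p` of `N/(x_0,…,x_{i-1})N` with `dim(R/p) > k`. -/
def IsSeqInDimGT (R : Type) [CommRing R] (N : Type) [AddCommGroup N] [Module R N]
    (k : ℤ) {r : ℕ} (x : Fin r → R) : Prop :=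
  ∀ i : Fin r, ∀ p ∈ associatedPrimes R (N ⧸ (prefIdeal x (i : ℕ) • ⊤ : Submodule R N)),
    zdim k < ringKrullDim (R ⧸ p) → x i ∉ p

/-- `depth_k(I,N)`: the common length of maximal `N`-sequences in dimension `> k`
contained in `I` (realized as the supremum of lengths of such sequences). -/
noncomputable def depthK (R : Type) [CommRing R] (k : ℤ) (I : Ideal R)
    (N : Type) [AddCommGroup N] [Module R N] : ℕ∞ :=
  sSup {n : ℕ∞ | ∃ (r : ℕ) (x : Fin r → R),
    (∀ i, x i ∈ I) ∧ IsSeqInDimGT R N k x ∧ n = (r : ℕ∞)}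

/-- The set of prime (or arbitrary) ideals `p` with `dim(R/p) ≥ k`. -/
def dimGE (R : Type) [CommRing R] (k : ℤ) : Set (Ideal R) :=
  {p | zdim k ≤ ringKrullDim (R ⧸ p)}

section LeftDerived

open Limits

lemma exists_exact_of_isos {D : Type*} [Category* D] [HasZeroMorphisms D]
    {A₁ A₂ A₃ : D} {S : ShortComplex D} (hS : S.Exact) (e₁ : A₁ ≅ S.X₁) (e₂ : A₂ ≅ S.X₂)
    (e₃ : A₃ ≅ S.X₃) {f : A₁ ⟶ A₂} {g : A₂ ⟶ A₃} (hf : f = e₁.hom ≫ S.f ≫ e₂.inv)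
    (hg : g = e₂.hom ≫ S.g ≫ e₃.inv) :
    ∃ h, (ShortComplex.mk f g h).Exact := by
  have h : f ≫ g = 0 := by simp [hf, hg]
  exact ⟨h, ShortComplex.exact_of_iso (ShortComplex.isoMk e₁.symm e₂.symm e₃.symm
    (by simp [hf]) (by simp [hg])) hS⟩

lemma comp_comp_comp_naturality {D : Type*} [Category* D] {A₁ A₂ A₃ A₄ B₁ B₂ B₃ B₄ : D}
    {e : A₁ ⟶ A₂} {d : A₂ ⟶ A₃} {i : A₃ ⟶ A₄} {e' : B₁ ⟶ B₂} {d' : B₂ ⟶ B₃} {i' : B₃ ⟶ B₄}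
    {m₁ : A₁ ⟶ B₁} {m₂ : A₂ ⟶ B₂} {m₃ : A₃ ⟶ B₃} {m₄ : A₄ ⟶ B₄}
    (h₁ : m₁ ≫ e' = e ≫ m₂) (h₂ : d ≫ m₃ = m₂ ≫ d') (h₃ : i ≫ m₄ = m₃ ≫ i') :
    m₁ ≫ e' ≫ d' ≫ i' = (e ≫ d ≫ i) ≫ m₄ := by
  rw [← Category.assoc, h₁, Category.assoc, Category.assoc, Category.assoc, h₃,
    ← Category.assoc d, h₂, Category.assoc]

variable {C D : Type*} [Category* C] [Category* D] [Abelian C] [Abelian D]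
  {F G H : C ⥤ D} [F.Additive] [G.Additive] [H.Additive] (α : F ⟶ G) (β : G ⟶ H)
  (w : α ≫ β = 0)

/-- The short complex of chain complexes obtained by applying a composable pair of natural
transformations with zero composition to a chain complex. -/
@[simps]
noncomputable def mapComplexShortComplex (K : ChainComplex C ℕ) :
    ShortComplex (ChainComplex D ℕ) where
  X₁ := (F.mapHomologicalComplex _).obj K
  X₂ := (G.mapHomologicalComplex _).obj K
  X₃ := (H.mapHomologicalComplex _).obj K
  f := (NatTrans.mapHomologicalComplex α _).app K
  g := (NatTrans.mapHomologicalComplex β _).app K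
  zero := by
    ext i
    exact NatTrans.congr_app w (K.X i)

/-- Functoriality of `mapComplexShortComplex` in the chain complex. -/
@[simps]
noncomputable def mapComplexShortComplexMap {K L : ChainComplex C ℕ} (φ : K ⟶ L) :
    mapComplexShortComplex α β w K ⟶ mapComplexShortComplex α β w L where
  τ₁ := (F.mapHomologicalComplex _).map φ
  τ₂ := (G.mapHomologicalComplex _).map φ
  τ₃ := (H.mapHomologicalComplex _).map φ
  comm₁₂ := (NatTrans.mapHomologicalComplex α _).naturality φ
  comm₂₃ := (NatTrans.mapHomologicalComplex β _).naturality φ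

variable (hS : ∀ P : C, Projective P →
  (ShortComplex.mk (α.app P) (β.app P) (NatTrans.congr_app w P)).ShortExact)

include hS in
lemma shortExact_mapComplexShortComplex {X : C} (P : ProjectiveResolution X) :
    (mapComplexShortComplex α β w P.complex).ShortExact :=
  HomologicalComplex.shortExact_of_degreewise_shortExact _ fun i => hS _ (P.projective i)

variable [EnoughProjectives C]

/-- The connecting morphism between left derived functors attached to a sequence of functors
which is short exact on projective objects. -/
noncomputable def leftDerivedδ (n : ℕ) : H.leftDerived (n + 1) ⟶ F.leftDerived n where
  app X := ((projectiveResolution X).isoLeftDerivedObj H (n + 1)).hom ≫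
    (shortExact_mapComplexShortComplex α β w hS (projectiveResolution X)).δ (n + 1) n (by simp) ≫
    ((projectiveResolution X).isoLeftDerivedObj F n).inv
  naturality X Y f := by
    have comm := ProjectiveResolution.lift_commutes_zero f (projectiveResolution X)
      (projectiveResolution Y)
    set φ := ProjectiveResolution.lift f (projectiveResolution X) (projectiveResolution Y)
    exact comp_comp_comp_naturality
      (ProjectiveResolution.isoLeftDerivedObj_hom_naturality f _ _ φ comm H (n + 1))
      (HomologicalComplex.HomologySequence.δ_naturality
        (mapComplexShortComplexMap α β w φ) _ _ _ _ _)
      (ProjectiveResolution.isoLeftDerivedObj_inv_naturality f _ _ φ comm F n)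

lemma leftDerived_exact₁ (n : ℕ) (X : C) :
    ∃ h, (ShortComplex.mk ((leftDerivedδ α β w hS n).app X)
      ((NatTrans.leftDerived α n).app X) h).Exact :=
  exists_exact_of_isos
    ((shortExact_mapComplexShortComplex α β w hS (projectiveResolution X)).homology_exact₁
      (n + 1) n (by simp))
    ((projectiveResolution X).isoLeftDerivedObj H (n + 1))
    ((projectiveResolution X).isoLeftDerivedObj F n)
    ((projectiveResolution X).isoLeftDerivedObj G n) rfl
    ((projectiveResolution X).leftDerived_app_eq α n)

include hS in
lemma leftDerived_exact₂ (n : ℕ) (X : C) :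
    ∃ h, (ShortComplex.mk ((NatTrans.leftDerived α n).app X)
      ((NatTrans.leftDerived β n).app X) h).Exact :=
  exists_exact_of_isos
    ((shortExact_mapComplexShortComplex α β w hS (projectiveResolution X)).homology_exact₂ n)
    ((projectiveResolution X).isoLeftDerivedObj F n)
    ((projectiveResolution X).isoLeftDerivedObj G n)
    ((projectiveResolution X).isoLeftDerivedObj H n)
    ((projectiveResolution X).leftDerived_app_eq α n)
    ((projectiveResolution X).leftDerived_app_eq β n)

lemma leftDerived_exact₃ (n : ℕ) (X : C) :
    ∃ h, (ShortComplex.mk ((NatTrans.leftDerived β (n + 1)).app X)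
      ((leftDerivedδ α β w hS n).app X) h).Exact :=
  exists_exact_of_isos
    ((shortExact_mapComplexShortComplex α β w hS (projectiveResolution X)).homology_exact₃
      (n + 1) n (by simp))
    ((projectiveResolution X).isoLeftDerivedObj G (n + 1))
    ((projectiveResolution X).isoLeftDerivedObj H (n + 1))
    ((projectiveResolution X).isoLeftDerivedObj F n)
    ((projectiveResolution X).leftDerived_app_eq β (n + 1)) rfl

end LeftDerived

section LinearOp

variable {R : Type*} [Semiring R] {C : Type*} [Category* C] [Preadditive C] [Linear R C]

instance linearOpposite : Linear R Cᵒᵖ where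
  homModule _ _ :=
    { smul a f := (a • f.unop).op
      one_smul f := congrArg Quiver.Hom.op (one_smul R f.unop)
      mul_smul a b f := congrArg Quiver.Hom.op (mul_smul a b f.unop)
      smul_zero a := congrArg Quiver.Hom.op (smul_zero a)
      smul_add a f g := congrArg Quiver.Hom.op (smul_add a f.unop g.unop)
      add_smul a b f := congrArg Quiver.Hom.op (add_smul a b f.unop)
      zero_smul f := congrArg Quiver.Hom.op (zero_smul R f.unop) }
  smul_comp _ _ _ a f g := congrArg Quiver.Hom.op (Linear.comp_smul _ _ _ g.unop a f.unop)
  comp_smul _ _ _ f a g := congrArg Quiver.Hom.op (Linear.smul_comp _ _ _ a g.unop f.unop)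

end LinearOp

section LinearDerived

lemma hom_smul_id_inv {R D : Type*} [Semiring R] [Category* D] [Preadditive D] [Linear R D]
    {X Y : D} (e : X ≅ Y) (a : R) : e.hom ≫ (a • 𝟙 Y) ≫ e.inv = a • 𝟙 X := by
  simp

variable {R : Type*} [CommRing R] {C D : Type*} [Category* C] [Category* D] [Abelian C] [Abelian D]
  [Linear R C] [Linear R D] [EnoughProjectives C]

lemma homologyMap_smul_id (a : R) (K : ChainComplex D ℕ) (n : ℕ) :
    HomologicalComplex.homologyMap (a • 𝟙 K) n = a • 𝟙 _ :=
  (ShortComplex.homologyMap_smul (𝟙 (K.sc n)) a).trans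
    (congrArg (a • ·) (ShortComplex.homologyMap_id _))

lemma leftDerived_map_smul_id (F : C ⥤ D) [F.Additive] [F.Linear R] (a : R) (n : ℕ) (X : C) :
    (F.leftDerived n).map (a • 𝟙 X) = a • 𝟙 _ := by
  have h : (F.mapHomologicalComplex (ComplexShape.down ℕ)).map
      (a • 𝟙 (projectiveResolution X).complex) = a • 𝟙 _ := by
    rw [Functor.map_smul, CategoryTheory.Functor.map_id]
  rw [F.leftDerived_map_eq n (a • 𝟙 X) (P := projectiveResolution X)
    (Q := projectiveResolution X) (a • 𝟙 _) (by
      ext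
      simp only [HomologicalComplex.comp_f, HomologicalComplex.smul_f_apply,
        Linear.smul_comp, Category.id_comp,
        ChainComplex.single₀_map_f_zero]
      exact ((Linear.comp_smul _ _ _ _ a (𝟙 X)).trans
        (congrArg (a • ·) (Category.comp_id _))).symm), Functor.comp_map, h]
  refine (congrArg (fun t => _ ≫ t ≫ _) (homologyMap_smul_id a _ n)).trans ?_
  exact hom_smul_id_inv _ a

omit [Linear R C] in
lemma leftDerived_natTrans_smul_id (F : C ⥤ D) [F.Additive] (α : F ⟶ F) (a : R)
    (hα : ∀ X, α.app X = a • 𝟙 _) (n : ℕ) (X : C) :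
    (NatTrans.leftDerived α n).app X = a • 𝟙 _ := by
  have h : (NatTrans.mapHomologicalComplex α (ComplexShape.down ℕ)).app
      (projectiveResolution X).complex = a • 𝟙 _ := by
    ext i
    exact hα _
  rw [(projectiveResolution X).leftDerived_app_eq α n, h]
  refine (congrArg (fun t => _ ≫ t ≫ _) (homologyMap_smul_id a _ n)).trans ?_
  exact hom_smul_id_inv _ a

end LinearDerived

section Ext

universe u

variable {R : Type u} [CommRing R]

lemma Ext_obj_map_smul_id (n : ℕ) (X : (ModuleCat.{u} R)ᵒᵖ) (Y : ModuleCat.{u} R) (a : R) :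
    ((Ext R (ModuleCat.{u} R) n).obj X).map (a • 𝟙 Y) = a • 𝟙 _ :=
  congrArg Quiver.Hom.unop <| leftDerived_natTrans_smul_id
    ((linearYoneda R (ModuleCat.{u} R)).obj Y).rightOp
    (((linearYoneda R (ModuleCat.{u} R)).map (a • 𝟙 Y)).rightOp) a
    (fun Z => by
      apply Quiver.Hom.unop_inj
      ext f
      exact congrArg (a • ·) (Category.comp_id f)) n X.unop

lemma Ext_map_smul_id_app (n : ℕ) (X Y : ModuleCat.{u} R) (a : R) :
    ((Ext R (ModuleCat.{u} R) n).map (a • 𝟙 X).op).app Y = a • 𝟙 _ :=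
  have : ((linearYoneda R (ModuleCat.{u} R)).obj Y).rightOp.Linear R :=
    { map_smul f b := by
        apply Quiver.Hom.unop_inj
        ext g
        exact Linear.smul_comp _ _ _ b f g }
  congrArg Quiver.Hom.unop <| leftDerived_map_smul_id
    ((linearYoneda R (ModuleCat.{u} R)).obj Y).rightOp a n X

variable {S : ShortComplex (ModuleCat.{u} R)} (hS : S.ShortExact)

lemma linearYoneda_map_rightOp_comp (S : ShortComplex (ModuleCat.{u} R)) :
    NatTrans.rightOp ((linearYoneda R (ModuleCat.{u} R)).map S.g) ≫
      NatTrans.rightOp ((linearYoneda R (ModuleCat.{u} R)).map S.f) = 0 := by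
  ext Z
  apply Quiver.Hom.unop_inj
  ext f
  exact (Category.assoc f S.f S.g).trans (by rw [S.zero]; exact Limits.comp_zero)

include hS in
lemma shortExact_linearYoneda (P : ModuleCat.{u} R) (_ : Projective P) :
    (ShortComplex.mk
      ((NatTrans.rightOp ((linearYoneda R (ModuleCat.{u} R)).map S.g)).app P)
      ((NatTrans.rightOp ((linearYoneda R (ModuleCat.{u} R)).map S.f)).app P)
      (NatTrans.congr_app (linearYoneda_map_rightOp_comp S) P)).ShortExact := by
  have := hS.mono_f
  have := hS.epi_g
  have h : (S.map ((linearCoyoneda R (ModuleCat.{u} R)).obj (op P))).ShortExact :=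
    { exact := (ShortComplex.moduleCat_exact_iff _).2 fun f hf =>
        ⟨hS.exact.lift f hf, hS.exact.lift_f f hf⟩
      mono_f := (ModuleCat.mono_iff_injective _).2 fun f g hfg => (cancel_mono S.f).1 hfg
      epi_g := (ModuleCat.epi_iff_surjective _).2 fun f =>
        ⟨Projective.factorThru f S.g, Projective.factorThru_comp f S.g⟩ }
  exact h.op

/-- The connecting morphism for `Ext` in the second variable. -/
noncomputable def Extδ (n : ℕ) : (Ext R (ModuleCat.{u} R) n).flip.obj S.X₃ ⟶
    (Ext R (ModuleCat.{u} R) (n + 1)).flip.obj S.X₁ :=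
  NatTrans.leftOp (leftDerivedδ _ _ (linearYoneda_map_rightOp_comp S)
    (shortExact_linearYoneda hS) n)

include hS in
lemma Ext_exact₂ (n : ℕ) (X : (ModuleCat.{u} R)ᵒᵖ) :
    Function.Exact (((Ext R (ModuleCat.{u} R) n).obj X).map S.f)
      (((Ext R (ModuleCat.{u} R) n).obj X).map S.g) := by
  obtain ⟨h, h'⟩ := leftDerived_exact₂ _ _ (linearYoneda_map_rightOp_comp S)
    (shortExact_linearYoneda hS) n X.unop
  exact (ShortComplex.ShortExact.moduleCat_exact_iff_function_exact _).1 h'.unop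

lemma Ext_exact₃ (n : ℕ) (X : (ModuleCat.{u} R)ᵒᵖ) :
    Function.Exact (((Ext R (ModuleCat.{u} R) n).obj X).map S.g) ((Extδ hS n).app X) := by
  obtain ⟨h, h'⟩ := leftDerived_exact₁ _ _ (linearYoneda_map_rightOp_comp S)
    (shortExact_linearYoneda hS) n X.unop
  exact (ShortComplex.ShortExact.moduleCat_exact_iff_function_exact _).1 h'.unop

lemma Ext_exact₁ (n : ℕ) (X : (ModuleCat.{u} R)ᵒᵖ) :
    Function.Exact ((Extδ hS n).app X)
      (((Ext R (ModuleCat.{u} R) (n + 1)).obj X).map S.f) := by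
  obtain ⟨h, h'⟩ := leftDerived_exact₃ _ _ (linearYoneda_map_rightOp_comp S)
    (shortExact_linearYoneda hS) n X.unop
  exact (ShortComplex.ShortExact.moduleCat_exact_iff_function_exact _).1 h'.unop

end Ext

section ExtZero

universe u

variable {R : Type u} [CommRing R]

lemma exists_Ext_zero_iso (Y : ModuleCat.{u} R) :
    Nonempty ((Ext R (ModuleCat.{u} R) 0).flip.obj Y ≅
      (linearYoneda R (ModuleCat.{u} R)).obj Y) := by
  have : Limits.PreservesFiniteLimits ((linearYoneda R (ModuleCat.{u} R)).obj Y) := by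
    have : Limits.PreservesFiniteLimits
        ((linearYoneda R (ModuleCat.{u} R)).obj Y ⋙ forget (ModuleCat.{u} R)) :=
      inferInstanceAs (Limits.PreservesFiniteLimits (yoneda.obj Y))
    exact Limits.preservesFiniteLimits_of_reflects_of_preserves _ (forget (ModuleCat.{u} R))
  have := Limits.preservesFiniteColimits_rightOp ((linearYoneda R (ModuleCat.{u} R)).obj Y)
  let e := ((linearYoneda R (ModuleCat.{u} R)).obj Y).rightOp.leftDerivedZeroIsoSelf
  exact ⟨NatIso.ofComponents (fun X => (e.app X.unop).symm.unop)
    (fun {X Z} f => congrArg Quiver.Hom.unop (e.inv.naturality f.unop).symm)⟩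

end ExtZero

section FilteredColimit

open Limits

variable {R : Type} [CommRing R] {J : Type} [SmallCategory J] [IsFiltered J]

lemma exact_of_isColimit {F G H : J ⥤ ModuleCat.{0} R} {u : F ⟶ G} {v : G ⟶ H}
    (huv : ∀ j, Function.Exact (u.app j) (v.app j))
    {cF : Cocone F} {cG : Cocone G} {cH : Cocone H}
    (hF : IsColimit cF) (hG : IsColimit cG) (hH : IsColimit cH)
    {f : cF.pt ⟶ cG.pt} {g : cG.pt ⟶ cH.pt}
    (hf : ∀ j, cF.ι.app j ≫ f = u.app j ≫ cG.ι.app j)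
    (hg : ∀ j, cG.ι.app j ≫ g = v.app j ≫ cH.ι.app j) :
    Function.Exact f g := by
  replace hf : ∀ j x, f (cF.ι.app j x) = cG.ι.app j (u.app j x) :=
    fun j x => ConcreteCategory.congr_hom (hf j) x
  replace hg : ∀ j x, g (cG.ι.app j x) = cH.ι.app j (v.app j x) :=
    fun j x => ConcreteCategory.congr_hom (hg j) x
  intro y
  constructor
  · intro hy
    obtain ⟨j, y, rfl⟩ := Concrete.isColimit_exists_rep G hG y
    rw [hg] at hy
    obtain ⟨k, s, t, h⟩ := Concrete.isColimit_exists_of_rep_eq H hH (v.app j y)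
      (0 : H.obj j) (hy.trans (map_zero _).symm)
    rw [map_zero] at h
    have h' : v.app k (G.map s y) = 0 :=
      (ConcreteCategory.congr_hom (v.naturality s) y).trans h
    obtain ⟨x, hx⟩ := (huv k _).1 h'
    exact ⟨cF.ι.app k x, by rw [hf, hx]; exact ConcreteCategory.congr_hom (cG.w s) y⟩
  · rintro ⟨x, rfl⟩
    obtain ⟨j, x, rfl⟩ := Concrete.isColimit_exists_rep F hF x
    rw [hf, hg, (huv j _).2 ⟨x, rfl⟩, map_zero]

end FilteredColimit

section LocalCohomology

open Limits localCohomology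

variable {R : Type} [CommRing R] (I : Ideal R)

/-- The direct system of modules `Ext^j(R/I^t, M)`. -/
noncomputable abbrev extSystem (j : ℕ) (M : ModuleCat.{0} R) : ℕᵒᵖᵒᵖ ⥤ ModuleCat.{0} R :=
  diagram (idealPowersDiagram I) j ⋙ (evaluation _ _).obj M

/-- The canonical maps from `Ext^j(R/I^t, M)` to local cohomology. -/
noncomputable def extCocone (j : ℕ) (M : ModuleCat.{0} R) : Cocone (extSystem I j M) :=
  ((evaluation _ _).obj M).mapCocone (colimit.cocone (diagram (idealPowersDiagram I) j))

/-- Local cohomology is the direct limit of the modules `Ext^j(R/I^t, M)`. -/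
noncomputable def isColimitExtCocone (j : ℕ) (M : ModuleCat.{0} R) : IsColimit (extCocone I j M) :=
  isColimitOfPreserves _ (colimit.isColimit _)

lemma extCocone_ι_map (j : ℕ) {M N : ModuleCat.{0} R} (f : M ⟶ N) (t : ℕᵒᵖᵒᵖ) :
    (extCocone I j M).ι.app t ≫ (localCohomology I j).map f =
      ((Ext R (ModuleCat.{0} R) j).obj _).map f ≫ (extCocone I j N).ι.app t :=
  (((colimit.cocone (diagram (idealPowersDiagram I) j)).ι.app t).naturality f).symm

lemma localCohomology_map_smul_id (j : ℕ) (M : ModuleCat.{0} R) (a : R) :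
    (localCohomology I j).map (a • 𝟙 M) = a • 𝟙 _ := by
  refine (isColimitExtCocone I j M).hom_ext fun t => ?_
  refine (extCocone_ι_map I j (a • 𝟙 M) t).trans ?_
  rw [Ext_obj_map_smul_id]
  exact (Linear.smul_comp _ _ _ a (𝟙 _) _).trans ((congrArg (a • ·) (by
    exact (Category.id_comp _).trans (Category.comp_id _).symm)).trans
    (Linear.comp_smul _ _ _ _ a (𝟙 _)).symm)

lemma exists_pow_smul_eq_zero (j : ℕ) (M : ModuleCat.{0} R) (z : (localCohomology I j).obj M) :
    ∃ t : ℕ, ∀ a ∈ I ^ t, a • z = 0 := by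
  obtain ⟨t, e, rfl⟩ := Concrete.isColimit_exists_rep _ (isColimitExtCocone I j M) z
  refine ⟨t.unop.unop, fun a ha => ?_⟩
  have h : a • 𝟙 ((ringModIdeals (idealPowersDiagram I)).obj t.unop) = 0 := by
    ext x
    obtain ⟨x, rfl⟩ := Submodule.Quotient.mk_surjective _ x
    exact (Submodule.Quotient.mk_eq_zero _).2 (Ideal.mul_mem_right _ _ ha)
  have h' : a • 𝟙 (((Ext R (ModuleCat.{0} R) j).obj
      (op ((ringModIdeals (idealPowersDiagram I)).obj t.unop))).obj M) = 0 := by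
    rw [← Ext_map_smul_id_app, h, ← zero_smul R (𝟙 _), Ext_map_smul_id_app, zero_smul]
  have h'' : a • e = 0 := congrArg (fun f => f.hom e) h'
  exact (map_smul ((extCocone I j M).ι.app t).hom a e).symm.trans
    ((congrArg _ h'').trans (map_zero ((extCocone I j M).ι.app t).hom))

variable {S : ShortComplex (ModuleCat.{0} R)} (hS : S.ShortExact)

/-- The connecting morphism in local cohomology. -/
noncomputable def localCohomologyδ (j : ℕ) :
    (localCohomology I j).obj S.X₃ ⟶ (localCohomology I (j + 1)).obj S.X₁ :=
  (isColimitExtCocone I j S.X₃).map (extCocone I (j + 1) S.X₁)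
    (Functor.whiskerLeft (ringModIdeals (idealPowersDiagram I)).op (Extδ hS j))

lemma extCocone_ι_δ (j : ℕ) (t : ℕᵒᵖᵒᵖ) :
    (extCocone I j S.X₃).ι.app t ≫ localCohomologyδ I hS j =
      (Extδ hS j).app _ ≫ (extCocone I (j + 1) S.X₁).ι.app t :=
  (isColimitExtCocone I j S.X₃).ι_map _ _ _

lemma localCohomology_exact₂ {S : ShortComplex (ModuleCat.{0} R)} (hS : S.ShortExact) (j : ℕ) :
    Function.Exact ((localCohomology I j).map S.f) ((localCohomology I j).map S.g) :=
  exact_of_isColimit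
    (u := Functor.whiskerLeft (diagram (idealPowersDiagram I) j) ((evaluation _ _).map S.f))
    (v := Functor.whiskerLeft (diagram (idealPowersDiagram I) j) ((evaluation _ _).map S.g))
    (fun _ => Ext_exact₂ hS j _) (isColimitExtCocone I j S.X₁) (isColimitExtCocone I j S.X₂)
    (isColimitExtCocone I j S.X₃) (extCocone_ι_map I j S.f) (extCocone_ι_map I j S.g)

lemma localCohomology_exact₃ (j : ℕ) :
    Function.Exact ((localCohomology I j).map S.g) (localCohomologyδ I hS j) :=
  exact_of_isColimit
    (u := Functor.whiskerLeft (diagram (idealPowersDiagram I) j) ((evaluation _ _).map S.g))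
    (v := Functor.whiskerLeft (ringModIdeals (idealPowersDiagram I)).op (Extδ hS j))
    (fun _ => Ext_exact₃ hS j _) (isColimitExtCocone I j S.X₂) (isColimitExtCocone I j S.X₃)
    (isColimitExtCocone I (j + 1) S.X₁) (extCocone_ι_map I j S.g) (extCocone_ι_δ I hS j)

lemma localCohomology_exact₁ (j : ℕ) :
    Function.Exact (localCohomologyδ I hS j) ((localCohomology I (j + 1)).map S.f) :=
  exact_of_isColimit
    (u := Functor.whiskerLeft (ringModIdeals (idealPowersDiagram I)).op (Extδ hS j))
    (v := Functor.whiskerLeft (diagram (idealPowersDiagram I) (j + 1)) ((evaluation _ _).map S.f))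
    (fun _ => Ext_exact₁ hS j _) (isColimitExtCocone I j S.X₃)
    (isColimitExtCocone I (j + 1) S.X₁) (isColimitExtCocone I (j + 1) S.X₂)
    (extCocone_ι_δ I hS j) (extCocone_ι_map I (j + 1) S.f)


lemma smul_extCocone_ι_eq_zero_iff {M : ModuleCat.{0} R}
    (i : (Ext R (ModuleCat.{0} R) 0).flip.obj M ≅ (linearYoneda R (ModuleCat.{0} R)).obj M)
    (t : ℕᵒᵖᵒᵖ) (e : (extSystem I 0 M).obj t) (a : R) :
    a • (show (localCohomology I 0).obj M from (extCocone I 0 M).ι.app t e) = 0 ↔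
      a • (show ModuleCat.of R (R ⧸ I ^ t.unop.unop) ⟶ M from
        i.hom.app (op ((ringModIdeals (idealPowersDiagram I)).obj t.unop)) e).hom
          (Submodule.Quotient.mk 1) = 0 := by
  have hinj (X : (ModuleCat.{0} R)ᵒᵖ) : Function.Injective (i.hom.app X).hom :=
    (ModuleCat.mono_iff_injective _).1 inferInstance
  have hsmul : a • (show (localCohomology I 0).obj M from (extCocone I 0 M).ι.app t e) =
      (extCocone I 0 M).ι.app t (a • e) := (map_smul ((extCocone I 0 M).ι.app t).hom a e).symm
  have hsmul' : i.hom.app (op ((ringModIdeals (idealPowersDiagram I)).obj t.unop)) (a • e) =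
      a • (show ModuleCat.of R (R ⧸ I ^ t.unop.unop) ⟶ M from
        i.hom.app (op ((ringModIdeals (idealPowersDiagram I)).obj t.unop)) e) :=
    map_smul (i.hom.app (op ((ringModIdeals (idealPowersDiagram I)).obj t.unop))).hom a e
  rw [hsmul]
  constructor
  · intro h
    obtain ⟨k, s, _, h⟩ := Concrete.isColimit_exists_of_rep_eq _ (isColimitExtCocone I 0 M) (a • e)
      (0 : (extSystem I 0 M).obj t) (h.trans (map_zero ((extCocone I 0 M).ι.app t).hom).symm)
    have h' := ConcreteCategory.congr_hom
      (i.hom.naturality ((ringModIdeals (idealPowersDiagram I)).map s.unop).op) (a • e)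
    have h'' : (ringModIdeals (idealPowersDiagram I)).map s.unop ≫
        i.hom.app (op ((ringModIdeals (idealPowersDiagram I)).obj t.unop)) (a • e) = 0 := by
      refine h'.symm.trans ((congrArg (i.hom.app
        (op ((ringModIdeals (idealPowersDiagram I)).obj k.unop))) ?_).trans
        (map_zero (i.hom.app _).hom))
      exact h.trans (map_zero ((extSystem I 0 M).map s).hom)
    rw [hsmul'] at h''
    exact congrArg (fun f => f.hom (Submodule.Quotient.mk 1)) h''
  · intro h
    have : a • e = 0 := by
      apply hinj (op ((ringModIdeals (idealPowersDiagram I)).obj t.unop))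
      refine hsmul'.trans (Eq.trans ?_ (map_zero _).symm)
      refine ModuleCat.hom_ext (LinearMap.ext fun y => ?_)
      obtain ⟨y, rfl⟩ := Submodule.Quotient.mk_surjective _ y
      let φ : (R ⧸ I ^ t.unop.unop) →ₗ[R] M := ModuleCat.Hom.hom
        (show ModuleCat.of R (R ⧸ I ^ t.unop.unop) ⟶ M from
        i.hom.app (op ((ringModIdeals (idealPowersDiagram I)).obj t.unop)) e)
      change a • φ (Submodule.Quotient.mk y) = 0
      have : (Submodule.Quotient.mk y : R ⧸ I ^ t.unop.unop) = y • Submodule.Quotient.mk 1 := by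
        rw [← Submodule.Quotient.mk_smul, smul_eq_mul, mul_one]
      rw [this, map_smul, smul_comm]
      exact (congrArg (y • ·) h).trans (smul_zero y)
    rw [this]
    exact map_zero ((extCocone I 0 M).ι.app t).hom

/-- Elements of `H⁰_I(M)` have the same annihilator as suitable elements of `M`. -/
lemma exists_smul_eq_zero_iff_of_localCohomology_zero (M : ModuleCat.{0} R)
    (z : (localCohomology I 0).obj M) : ∃ m : M, ∀ a : R, a • z = 0 ↔ a • m = 0 := by
  obtain ⟨t, e, rfl⟩ := Concrete.isColimit_exists_rep _ (isColimitExtCocone I 0 M) z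
  obtain ⟨i⟩ := exists_Ext_zero_iso (R := R) M
  exact ⟨_, smul_extCocone_ι_eq_zero_iff I i t e⟩

lemma exists_localCohomology_zero_smul_eq_zero_iff (M : ModuleCat.{0} R) (m : M)
    (hm : ∀ a ∈ I, a • m = 0) :
    ∃ z : (localCohomology I 0).obj M, ∀ a : R, a • z = 0 ↔ a • m = 0 := by
  obtain ⟨i⟩ := exists_Ext_zero_iso (R := R) M
  let φ : (R ⧸ I ^ 1) →ₗ[R] M := Submodule.liftQ _ (LinearMap.toSpanSingleton R M m)
    fun a ha => hm a (by simpa using ha)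
  let ψ : ((linearYoneda R (ModuleCat.{0} R)).obj M).obj
      (op ((ringModIdeals (idealPowersDiagram I)).obj (op 1))) := ModuleCat.ofHom φ
  have h := smul_extCocone_ι_eq_zero_iff I i (op (op 1))
    (i.inv.app (op ((ringModIdeals (idealPowersDiagram I)).obj (op 1))) ψ)
  refine ⟨_, fun a => (h a).trans ?_⟩
  have h' := ConcreteCategory.congr_hom (i.inv_hom_id_app
    (op ((ringModIdeals (idealPowersDiagram I)).obj (op 1)))) ψ
  have h'' : φ (Submodule.Quotient.mk 1) = m := one_smul R m
  rw [← h'']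
  exact iff_of_eq (congrArg (fun f : ModuleCat.of R (R ⧸ I ^ 1) ⟶ M =>
    a • f.hom (Submodule.Quotient.mk 1) = 0) h')

end LocalCohomology

section Torsion

variable {R : Type} [CommRing R]

/-- Every element of `M` is killed by an element outside `p`. -/
def TorsionAt (p : Ideal R) (M : Type) [AddCommGroup M] [Module R M] : Prop :=
  ∀ m : M, ∃ s ∉ p, s • m = 0

variable {A B M : Type} [AddCommGroup A] [Module R A] [AddCommGroup B] [Module R B]
  [AddCommGroup M] [Module R M]

lemma TorsionAt.exists_forall_smul_eq_zero {p : Ideal R} [p.IsPrime] [Module.Finite R M]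
    (h : TorsionAt p M) : ∃ s ∉ p, ∀ m : M, s • m = 0 := by
  have h' := (Module.notMem_support_iff' (p := ⟨p, inferInstance⟩)).2 h
  rw [Module.mem_support_iff_of_finite] at h'
  obtain ⟨s, hs, hsp⟩ := SetLike.not_le_iff_exists.1 h'
  exact ⟨s, hsp, Module.mem_annihilator.1 hs⟩

lemma torsionAt_of_pow_smul_eq_zero {p : Ideal R} [hp : p.IsPrime] (x : R)
    (hx : ∀ z : M, ∃ t : ℕ, x ^ t • z = 0) (h : ∀ z : M, x • z = 0 → ∃ s ∉ p, s • z = 0) :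
    TorsionAt p M := by
  intro z
  obtain ⟨t, ht⟩ := hx z
  induction t generalizing z with
  | zero => exact ⟨1, hp.one_notMem, by simpa using ht⟩
  | succ t ih =>
    obtain ⟨s, hs, hsz⟩ := h (x ^ t • z) (by rwa [smul_smul, ← pow_succ'])
    obtain ⟨s', hs', hsz'⟩ := ih (s • z) (by rwa [smul_comm])
    exact ⟨s' * s, hp.mul_notMem hs' hs, by rwa [mul_smul]⟩

variable [IsNoetherianRing R]

lemma mem_associatedPrimes_iff_exists {p : Ideal R} :
    p ∈ associatedPrimes R M ↔ p.IsPrime ∧ ∃ z : M, ∀ a, a ∈ p ↔ a • z = 0 := by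
  rw [AssociatedPrimes.mem_iff, isAssociatedPrime_iff]
  simp_rw [SetLike.ext_iff, Submodule.mem_colon_singleton, Submodule.mem_bot]

lemma torsionAt_iff {p : Ideal R} [hp : p.IsPrime] :
    TorsionAt p M ↔ ∀ q ∈ associatedPrimes R M, ¬ q ≤ p := by
  constructor
  · intro h q hq hqp
    obtain ⟨_, z, hz⟩ := mem_associatedPrimes_iff_exists.1 hq
    obtain ⟨s, hs, hsz⟩ := h z
    exact hs (hqp ((hz s).2 hsz))
  · intro h m
    by_contra! hm
    have hle : Module.annihilator R (Submodule.span R {m}) ≤ p := by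
      intro a ha
      by_contra hap
      exact hm a hap ((Submodule.mem_annihilator_span_singleton m a).1 ha)
    obtain ⟨q, hq, hqp⟩ := Ideal.exists_minimalPrimes_le hle
    exact h q (associatedPrimes.subset_of_injective (f := Submodule.subtype _)
      (Submodule.injective_subtype _)
      (Module.associatedPrimes.minimalPrimes_annihilator_subset_associatedPrimes R _ hq)) hqp

lemma exists_notMem_smul_eq_zero_of_smul_eq_zero [Module.Finite R M] {p : Ideal R} [p.IsPrime]
    {x : R} (hx : ∀ q ∈ associatedPrimes R M, q ≤ p → x ∉ q) :
    ∃ s ∉ p, ∀ m : M, x • m = 0 → s • m = 0 := by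
  have h : TorsionAt p (LinearMap.lsmul R M x).ker := by
    rw [torsionAt_iff]
    intro q hq hqp
    refine hx q (associatedPrimes.subset_of_injective (f := Submodule.subtype _)
      (Submodule.injective_subtype _) hq) hqp ?_
    obtain ⟨_, z, hz⟩ := mem_associatedPrimes_iff_exists.1 hq
    exact (hz x).2 (Subtype.ext z.2)
  obtain ⟨s, hs, hs'⟩ := h.exists_forall_smul_eq_zero
  exact ⟨s, hs, fun m hm => congrArg Subtype.val (hs' ⟨m, hm⟩)⟩

lemma mem_associatedPrimes_of_map {p : Ideal R} [hp : p.IsPrime] (f : A →ₗ[R] B)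
    (hf : ∀ z, f z = 0 → ∃ s ∉ p, s • z = 0) {z : A} (hz : ∀ a, a ∈ p ↔ a • f z = 0) :
    p ∈ associatedPrimes R A := by
  have h : TorsionAt p ((Submodule.map (LinearMap.toSpanSingleton R A z) p : Submodule R A)) := by
    rintro ⟨_, a, ha, rfl⟩
    obtain ⟨s, hs, hsa⟩ := hf (a • z) (by rw [map_smul]; exact (hz a).1 ha)
    exact ⟨s, hs, Subtype.ext hsa⟩
  obtain ⟨s, hs, hs'⟩ := h.exists_forall_smul_eq_zero
  refine mem_associatedPrimes_iff_exists.2 ⟨hp, s • z, fun a => ⟨fun ha => ?_, fun ha => ?_⟩⟩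
  · rw [smul_comm]
    exact congrArg Subtype.val (hs' ⟨a • z, a, ha, rfl⟩)
  · refine (hp.mem_or_mem ((hz (a * s)).2 ?_)).resolve_right hs
    rw [mul_smul, ← map_smul, ← map_smul, ha, map_zero]

end Torsion

section AvoidsAss

variable {R : Type} [CommRing R]

/-- Each entry of `rs` avoids the associated primes satisfying `P` of the quotient of `N` by the
preceding entries. -/
def AvoidsAss (P : Ideal R → Prop) (N : Type) [AddCommGroup N] [Module R N] (rs : List R) : Prop :=
  ∀ (i : ℕ) (hi : i < rs.length),
    ∀ q ∈ associatedPrimes R (N ⧸ (Ideal.ofList (rs.take i) • ⊤ : Submodule R N)), P q → rs[i] ∉ q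

variable {N : Type} [AddCommGroup N] [Module R N]

lemma AvoidsAss.mono {P Q : Ideal R → Prop} {rs : List R} (h : AvoidsAss P N rs)
    (hPQ : ∀ q, Q q → P q) : AvoidsAss Q N rs :=
  fun i hi q hq hqQ => h i hi q hq (hPQ q hqQ)

lemma associatedPrimes_quotient_ofList_nil :
    associatedPrimes R (N ⧸ (Ideal.ofList ([] : List R) • ⊤ : Submodule R N)) =
      associatedPrimes R N :=
  LinearEquiv.AssociatedPrimes.eq (Submodule.quotEquivOfEqBot _ (by simp))

lemma associatedPrimes_quotient_ofList_cons (x : R) (rs : List R) :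
    associatedPrimes R (N ⧸ (Ideal.ofList (x :: rs) • ⊤ : Submodule R N)) =
      associatedPrimes R
        (QuotSMulTop x N ⧸ (Ideal.ofList rs • ⊤ : Submodule R (QuotSMulTop x N))) :=
  LinearEquiv.AssociatedPrimes.eq
    (Submodule.quotOfListConsSMulTopEquivQuotSMulTopInner N x rs)

lemma AvoidsAss.head {P : Ideal R → Prop} {x : R} {rs : List R} (h : AvoidsAss P N (x :: rs)) :
    ∀ q ∈ associatedPrimes R N, P q → x ∉ q := by
  intro q hq
  refine h 0 (by simp) q ?_
  rwa [List.take_zero, associatedPrimes_quotient_ofList_nil]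

lemma AvoidsAss.tail {P : Ideal R → Prop} {x : R} {rs : List R} (h : AvoidsAss P N (x :: rs)) :
    AvoidsAss P (QuotSMulTop x N) rs := by
  intro i hi q hq
  refine h (i + 1) (by simpa using hi) q ?_
  rwa [List.take_succ_cons, associatedPrimes_quotient_ofList_cons]

end AvoidsAss

section AssociatedPrimes

open scoped Pointwise

variable {R : Type} [CommRing R] (I : Ideal R)

/-- The `j`-th local cohomology module of `N`. -/
noncomputable abbrev LocalCohomologyModule (j : ℕ) (N : Type) [AddCommGroup N] [Module R N] :
    Type :=
  (localCohomology I j).obj (ModuleCat.of R N)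

lemma localCohomology_smul_eq_zero (j : ℕ) {K : Type} [AddCommGroup K] [Module R K] {s : R}
    (hs : ∀ k : K, s • k = 0) (z : LocalCohomologyModule I j K) : s • z = 0 := by
  have h : s • 𝟙 (ModuleCat.of R K) = (0 : R) • 𝟙 _ := by
    ext k
    exact (hs k).trans (zero_smul R k).symm
  have h' := congrArg (localCohomology I j).map h
  rw [localCohomology_map_smul_id, localCohomology_map_smul_id] at h'
  exact (congrArg (fun f => f.hom z) h').trans (zero_smul R z)

/-- The maps induced in local cohomology by the factorization `N → xN → N` of multiplication
by `x`. -/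
lemma exists_localCohomology_smul_maps (N : Type) [AddCommGroup N] [Module R N] (x : R) :
    ∃ (X : ℕ → ModuleCat.{0} R)
      (φ : ∀ j, LocalCohomologyModule I j N →ₗ[R] X j)
      (ι : ∀ j, X j →ₗ[R] LocalCohomologyModule I j N)
      (π : ∀ j, LocalCohomologyModule I j N →ₗ[R] LocalCohomologyModule I j (QuotSMulTop x N))
      (δ : ∀ j, LocalCohomologyModule I j (QuotSMulTop x N) →ₗ[R] X (j + 1)),
      (∀ j z, ι j (φ j z) = x • z) ∧ (∀ j, Function.Exact (π j) (δ j)) ∧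
      (∀ j, Function.Exact (δ j) (ι (j + 1))) ∧
      ∀ s : R, (∀ n : N, x • n = 0 → s • n = 0) →
        (∀ j z, φ j z = 0 → s • z = 0) ∧ ∀ j w, ∃ z, φ j z = s • w := by
  let f := LinearMap.lsmul R N x
  let S : ShortComplex (ModuleCat.{0} R) := ShortComplex.mk (ModuleCat.ofHom f.ker.subtype)
    (ModuleCat.ofHom f.rangeRestrict) (by ext n; exact n.2)
  have hSf : Function.Exact S.f S.g := by
    refine fun n => ⟨fun hn => ⟨⟨n, congrArg Subtype.val hn⟩, rfl⟩, ?_⟩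
    rintro ⟨n, rfl⟩
    exact Subtype.ext n.2
  have hS : S.ShortExact :=
    { exact := (ShortComplex.ShortExact.moduleCat_exact_iff_function_exact S).2 hSf
      mono_f := (ModuleCat.mono_iff_injective _).2 (Submodule.injective_subtype _)
      epi_g := (ModuleCat.epi_iff_surjective _).2 f.surjective_rangeRestrict }
  let T : ShortComplex (ModuleCat.{0} R) := ShortComplex.mk (ModuleCat.ofHom f.range.subtype)
    (ModuleCat.ofHom (x • ⊤ : Submodule R N).mkQ) (by
      ext n
      obtain ⟨_, n, rfl⟩ := n
      exact (Submodule.Quotient.mk_eq_zero _).2 (Submodule.smul_mem_pointwise_smul n x ⊤ trivial))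
  have hTf : Function.Exact T.f T.g := by
    refine fun n => (Submodule.Quotient.mk_eq_zero _).trans ⟨?_, ?_⟩
    · rintro ⟨n, _, rfl⟩
      exact ⟨⟨_, n, rfl⟩, rfl⟩
    · rintro ⟨⟨_, n, rfl⟩, rfl⟩
      exact Submodule.smul_mem_pointwise_smul n x ⊤ trivial
  have hT : T.ShortExact :=
    { exact := (ShortComplex.ShortExact.moduleCat_exact_iff_function_exact T).2 hTf
      mono_f := (ModuleCat.mono_iff_injective _).2 (Submodule.injective_subtype _)
      epi_g := (ModuleCat.epi_iff_surjective _).2 (Submodule.mkQ_surjective _) }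
  refine ⟨fun j => (localCohomology I j).obj (ModuleCat.of R f.range),
    fun j => ((localCohomology I j).map S.g).hom, fun j => ((localCohomology I j).map T.f).hom,
    fun j => ((localCohomology I j).map T.g).hom, fun j => (localCohomologyδ I hT j).hom,
    fun j z => ?_, fun j => localCohomology_exact₃ I hT j, fun j => localCohomology_exact₁ I hT j,
    fun s hs => ⟨fun j z hz => ?_, fun j w => ?_⟩⟩
  · have h : S.g ≫ T.f = x • 𝟙 (ModuleCat.of R N) := rfl
    have h' := (localCohomology I j).map_comp S.g T.f
    rw [h, localCohomology_map_smul_id] at h'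
    exact (congrArg (fun g => g.hom z) h').symm
  · obtain ⟨y, rfl⟩ := (localCohomology_exact₂ I hS j z).1 hz
    have : s • y = 0 :=
      localCohomology_smul_eq_zero I j (fun k : f.ker => Subtype.ext (hs k.1 k.2)) y
    refine (map_smul ((localCohomology I j).map S.f).hom s y).symm.trans ?_
    exact (congrArg _ this).trans (map_zero ((localCohomology I j).map S.f).hom)
  · refine (localCohomology_exact₃ I hS j (s • w)).1 ?_
    exact (map_smul (localCohomologyδ I hS j).hom s w).trans (localCohomology_smul_eq_zero I (j + 1)
      (fun k : f.ker => Subtype.ext (hs k.1 k.2)) _)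

variable [IsNoetherianRing R]

lemma le_of_mem_associatedPrimes_localCohomology {j : ℕ} {N : Type} [AddCommGroup N] [Module R N]
    {p : Ideal R} (hp : p ∈ associatedPrimes R (LocalCohomologyModule I j N)) : I ≤ p := by
  obtain ⟨hp', z, hz⟩ := mem_associatedPrimes_iff_exists.1 hp
  obtain ⟨t, ht⟩ := exists_pow_smul_eq_zero I j (ModuleCat.of R N) z
  exact fun a ha => hp'.mem_of_pow_mem t ((hz _).2 (ht _ (Ideal.pow_mem_pow ha t)))

lemma associatedPrimes_localCohomology_zero_subset (N : Type) [AddCommGroup N] [Module R N] :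
    associatedPrimes R (LocalCohomologyModule I 0 N) ⊆ associatedPrimes R N := by
  intro p hp
  obtain ⟨hp', z, hz⟩ := mem_associatedPrimes_iff_exists.1 hp
  obtain ⟨m, hm⟩ := exists_smul_eq_zero_iff_of_localCohomology_zero I (ModuleCat.of R N) z
  exact mem_associatedPrimes_iff_exists.2 ⟨hp', m, fun a => (hz a).trans (hm a)⟩

lemma mem_associatedPrimes_localCohomology_zero {N : Type} [AddCommGroup N] [Module R N]
    {p : Ideal R} (hIp : I ≤ p) (hp : p ∈ associatedPrimes R N) :
    p ∈ associatedPrimes R (LocalCohomologyModule I 0 N) := by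
  obtain ⟨hp', m, hm⟩ := mem_associatedPrimes_iff_exists.1 hp
  obtain ⟨z, hz⟩ := exists_localCohomology_zero_smul_eq_zero_iff I (ModuleCat.of R N) m
    fun a ha => (hm a).1 (hIp ha)
  exact mem_associatedPrimes_iff_exists.2 ⟨hp', z, fun a => (hm a).trans (hz a).symm⟩

/-- Local cohomology vanishes locally at `p` below the length of a sequence which is regular
locally at `p`. -/
lemma torsionAt_localCohomology {p : Ideal R} [hp : p.IsPrime] {rs : List R} (hrs : ∀ a ∈ rs, a ∈ I)
    {N : Type} [AddCommGroup N] [Module R N] [Module.Finite R N] (h : AvoidsAss (· ≤ p) N rs)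
    {j : ℕ} (hj : j < rs.length) : TorsionAt p (LocalCohomologyModule I j N) := by
  induction rs generalizing N j with
  | nil => simp at hj
  | cons x rs ih =>
    cases j with
    | zero =>
      refine torsionAt_iff.2 fun q hq hqp => ?_
      exact h.head q (associatedPrimes_localCohomology_zero_subset I N hq) hqp
        (le_of_mem_associatedPrimes_localCohomology I hq (hrs x (by simp)))
    | succ j =>
      obtain ⟨s, hs, hsx⟩ := exists_notMem_smul_eq_zero_of_smul_eq_zero h.head
      obtain ⟨X, φ, ι, π, δ, hιφ, -, hδι, hφ⟩ := exists_localCohomology_smul_maps I N x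
      refine torsionAt_of_pow_smul_eq_zero x (fun z => ?_) fun z hz => ?_
      · obtain ⟨t, ht⟩ := exists_pow_smul_eq_zero I (j + 1) (ModuleCat.of R N) z
        exact ⟨t, ht _ (Ideal.pow_mem_pow (hrs x (by simp)) t)⟩
      · obtain ⟨w, hw⟩ := (hδι j (φ (j + 1) z)).1 ((hιφ _ z).trans hz)
        obtain ⟨s', hs', hsw⟩ := ih (fun a ha => hrs a (by simp [ha])) h.tail
          (Nat.lt_of_succ_lt_succ hj) w
        refine ⟨s * s', hp.mul_notMem hs hs', ?_⟩
        rw [mul_smul]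
        refine (hφ s hsx).1 (j + 1) (s' • z) ?_
        rw [map_smul, ← hw, ← map_smul, hsw, map_zero]

lemma exists_mem_associatedPrimes_localCohomology_iff {p : Ideal R} [hp : p.IsPrime] (hIp : I ≤ p)
    {rs : List R} (hrs : ∀ a ∈ rs, a ∈ I) {N : Type} [AddCommGroup N] [Module R N]
    [Module.Finite R N] (h : AvoidsAss (· < p) N rs) :
    (∃ j ≤ rs.length, p ∈ associatedPrimes R (LocalCohomologyModule I j N)) ↔
      ∃ j ≤ rs.length,
        p ∈ associatedPrimes R (N ⧸ (Ideal.ofList (rs.take j) • ⊤ : Submodule R N)) := by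
  induction rs generalizing N with
  | nil =>
    simp only [List.length_nil, nonpos_iff_eq_zero, exists_eq_left]
    rw [List.take_nil, associatedPrimes_quotient_ofList_nil]
    exact ⟨fun h => associatedPrimes_localCohomology_zero_subset I N h,
      mem_associatedPrimes_localCohomology_zero I hIp⟩
  | cons x rs ih =>
    by_cases hpN : p ∈ associatedPrimes R N
    · refine iff_of_true ⟨0, zero_le, mem_associatedPrimes_localCohomology_zero I hIp hpN⟩
        ⟨0, zero_le, ?_⟩
      rwa [List.take_zero, associatedPrimes_quotient_ofList_nil]
    have hx : x ∈ p := hIp (hrs x (by simp))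
    have hcons : (∃ j ≤ (x :: rs).length, p ∈ associatedPrimes R
        (N ⧸ (Ideal.ofList ((x :: rs).take j) • ⊤ : Submodule R N))) ↔ ∃ j ≤ rs.length,
        p ∈ associatedPrimes R (QuotSMulTop x N ⧸
          (Ideal.ofList (rs.take j) • ⊤ : Submodule R (QuotSMulTop x N))) := by
      constructor
      · rintro ⟨_ | j, hj, hpj⟩
        · rw [List.take_zero, associatedPrimes_quotient_ofList_nil] at hpj
          exact absurd hpj hpN
        · rw [List.take_succ_cons, associatedPrimes_quotient_ofList_cons] at hpj
          exact ⟨j, Nat.le_of_succ_le_succ hj, hpj⟩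
      · rintro ⟨j, hj, hpj⟩
        refine ⟨j + 1, Nat.succ_le_succ hj, ?_⟩
        rwa [List.take_succ_cons, associatedPrimes_quotient_ofList_cons]
    rw [hcons, ← ih (fun a ha => hrs a (by simp [ha])) h.tail]
    have htor {j : ℕ} (hj : j < (x :: rs).length)
        (hpj : p ∉ associatedPrimes R (LocalCohomologyModule I j N)) :
        TorsionAt p (LocalCohomologyModule I j N) := by
      refine torsionAt_iff.2 fun q hq hqp => ?_
      have hlt : q < p := lt_of_le_of_ne hqp fun h => hpj (h ▸ hq)
      have : q.IsPrime := hq.isPrime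
      exact torsionAt_iff.1 (torsionAt_localCohomology I hrs
        (h.mono fun q' hq' => lt_of_le_of_lt hq' hlt) hj) q hq le_rfl
    obtain ⟨s, hs, hsx⟩ := exists_notMem_smul_eq_zero_of_smul_eq_zero (M := N) (p := p) (x := x)
      fun q hq hqp => h.head q hq (lt_of_le_of_ne hqp fun h => hpN (h ▸ hq))
    obtain ⟨X, φ, ι, π, δ, hιφ, hπδ, hδι, hφ⟩ := exists_localCohomology_smul_maps I N x
    obtain ⟨hker, hcoker⟩ := hφ s hsx
    have hδ {j : ℕ} (hj : TorsionAt p (LocalCohomologyModule I j N))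
        (w : LocalCohomologyModule I j (QuotSMulTop x N)) (hw : δ j w = 0) :
        ∃ s ∉ p, s • w = 0 := by
      obtain ⟨v, rfl⟩ := (hπδ j w).1 hw
      obtain ⟨s, hs, hsv⟩ := hj v
      exact ⟨s, hs, by rw [← map_smul, hsv, map_zero]⟩
    constructor
    · intro hex
      classical
      obtain ⟨hj, hpj⟩ := Nat.find_spec hex
      have hmin := fun i => Nat.find_min (m := i) hex
      generalize Nat.find hex = j at hj hpj hmin
      cases j with
      | zero => exact absurd (associatedPrimes_localCohomology_zero_subset I N hpj) hpN
      | succ j =>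
        obtain ⟨_, z, hz⟩ := mem_associatedPrimes_iff_exists.1 hpj
        obtain ⟨w, hw⟩ := (hδι j (φ (j + 1) z)).1 ((hιφ _ z).trans ((hz x).1 hx))
        refine ⟨j, Nat.le_of_succ_le_succ hj, mem_associatedPrimes_of_map (δ j) (hδ (htor hj
          fun h => hmin j j.lt_succ_self ⟨by omega, h⟩)) (z := w) fun a => ?_⟩
        rw [hw, ← map_smul]
        constructor
        · intro ha
          rw [(hz a).1 ha, map_zero]
        · intro ha
          refine (hp.mem_or_mem ((hz (s * a)).2 ?_)).resolve_left hs
          rw [mul_smul, hker _ _ ha]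
    · rintro ⟨j, hj, hpj⟩
      by_cases hpj' : p ∈ associatedPrimes R (LocalCohomologyModule I j N)
      · exact ⟨j, hj.trans (Nat.le_succ _), hpj'⟩
      obtain ⟨_, w, hw⟩ := mem_associatedPrimes_iff_exists.1 hpj
      obtain ⟨z, hz⟩ := hcoker (j + 1) (δ j w)
      refine ⟨j + 1, Nat.succ_le_succ hj, mem_associatedPrimes_of_map (φ (j + 1))
        (fun z hz => ⟨s, hs, hker _ z hz⟩) (z := z) fun a => ?_⟩
      rw [hz, ← map_smul, ← map_smul]
      constructor
      · intro ha
        rw [smul_comm, (hw a).1 ha, smul_zero, map_zero]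
      · intro ha
        obtain ⟨s', hs', hsw⟩ := hδ (htor (Nat.lt_succ_of_le hj) hpj') _ ha
        rw [← mul_smul, ← mul_smul, ← hw] at hsw
        exact ((hp.mem_or_mem ((hp.mem_or_mem hsw).resolve_right hs)).resolve_left hs')

end AssociatedPrimes

lemma ringKrullDim_quotient_lt_of_lt {R : Type} [CommRing R] [IsNoetherianRing R] [IsLocalRing R]
    {p q : Ideal R} [hp : p.IsPrime] [q.IsPrime] (h : q < p) :
    ringKrullDim (R ⧸ p) < ringKrullDim (R ⧸ q) := by
  obtain ⟨a, hap, haq⟩ := Set.exists_of_ssubset h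
  have ha : Ideal.Quotient.mk q a ∈ nonZeroDivisors (R ⧸ q) :=
    mem_nonZeroDivisors_of_ne_zero fun h => haq (Ideal.Quotient.eq_zero_iff_mem.1 h)
  have hle : Ideal.span {Ideal.Quotient.mk q a} ≤ RingHom.ker (Ideal.Quotient.factor h.le) := by
    rw [Ideal.span_singleton_le_iff_mem, RingHom.mem_ker]
    exact Ideal.Quotient.eq_zero_iff_mem.2 hap
  have hdim : ringKrullDim (R ⧸ p) ≤ ringKrullDim ((R ⧸ q) ⧸ Ideal.span {Ideal.Quotient.mk q a}) :=
    ringKrullDim_le_of_surjective (Ideal.Quotient.lift _ _ hle)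
      (Ideal.Quotient.lift_surjective_of_surjective _ _ (Ideal.Quotient.factor_surjective h.le))
  have hlt : ringKrullDim (R ⧸ p) < ringKrullDim (R ⧸ p) + 1 := by
    have : IsLocalRing (R ⧸ p) :=
      IsLocalRing.of_surjective' (Ideal.Quotient.mk p) Ideal.Quotient.mk_surjective
    obtain ⟨n, hn⟩ : ∃ n : ℕ, ringKrullDim (R ⧸ p) = n := by
      have := ringKrullDim_ne_top (R := R ⧸ p)
      have := ringKrullDim_ne_bot (R := R ⧸ p)
      generalize ringKrullDim (R ⧸ p) = d at *
      induction d using WithBot.recBotCoe with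
      | bot => contradiction
      | coe d =>
        induction d using WithTop.recTopCoe with
        | top => contradiction
        | coe n => exact ⟨n, rfl⟩
    rw [hn]
    exact_mod_cast n.lt_succ_self
  exact hlt.trans_le ((add_le_add_left hdim 1).trans
    (ringKrullDim_quotient_succ_le_of_nonZeroDivisor ha))

lemma ofList_take_ofFn {R : Type} [CommRing R] {r : ℕ} (x : Fin r → R) (j : ℕ) :
    Ideal.ofList ((List.ofFn x).take j) = prefIdeal x j := by
  refine congrArg Ideal.span (Set.ext fun a => ?_)
  simp only [Set.mem_ofPred_eq, List.mem_take_iff_getElem, Set.mem_image, List.length_ofFn,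
    List.getElem_ofFn, lt_min_iff]
  exact ⟨fun ⟨i, hi, h⟩ => ⟨⟨i, hi.2⟩, hi.1, h⟩, fun ⟨i, hi, h⟩ => ⟨i, ⟨hi, i.2⟩, h⟩⟩

/-- Theorem 1.1 (ordinary local cohomology): if `r = depth_k(I,N) < ∞` and `x₁,…,x_r` is an
`N`-sequence in dimension `> k` in `I`, then for all `l ≤ r`,
`⋃_{j≤l} Ass_R(H^j_I(N))_{≥k} = ⋃_{j≤l} Ass_R(N/(x₁,…,x_j)N)_{≥k} ∩ V(I)`. -/
theorem ass_localCohomology_eq (R : Type) [CommRing R] [IsNoetherianRing R] [IsLocalRing R]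
    (I : Ideal R) (N : Type) [AddCommGroup N] [Module R N] [Module.Finite R N]
    (k : ℤ) (hk : -1 ≤ k) (r : ℕ) (hr : depthK R k I N = (r : ℕ∞))
    (x : Fin r → R) (hxI : ∀ i, x i ∈ I) (hx : IsSeqInDimGT R N k x)
    (l : ℕ) (hl : l ≤ r) :
    (⋃ j ≤ l, associatedPrimes R ((localCohomology I j).obj (ModuleCat.of R N)) ∩ dimGE R k)
      = ⋃ j ≤ l, (associatedPrimes R (N ⧸ (prefIdeal x j • ⊤ : Submodule R N))
          ∩ dimGE R k ∩ {p | I ≤ p}) := by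
  have hrs : ∀ a ∈ (List.ofFn x).take l, a ∈ I := by
    intro a ha
    obtain ⟨i, rfl⟩ := (List.mem_ofFn' x a).1 (List.mem_of_mem_take ha)
    exact hxI i
  have hlen : ((List.ofFn x).take l).length = l := by simpa using hl
  have hiff {p : Ideal R} (hp : p.IsPrime) (hpk : p ∈ dimGE R k) (hIp : I ≤ p) :
      (∃ j ≤ l, p ∈ associatedPrimes R ((localCohomology I j).obj (ModuleCat.of R N))) ↔
        ∃ j ≤ l, p ∈ associatedPrimes R (N ⧸ (prefIdeal x j • ⊤ : Submodule R N)) := by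
    have havoid : AvoidsAss (· < p) N ((List.ofFn x).take l) := by
      intro i hi q hq hqp
      have hil : i < l := hlen ▸ hi
      rw [List.take_take, min_eq_left hil.le, ofList_take_ofFn] at hq
      rw [List.getElem_take, List.getElem_ofFn]
      have : q.IsPrime := hq.isPrime
      exact hx ⟨i, hil.trans_le hl⟩ q hq (hpk.trans_lt (ringKrullDim_quotient_lt_of_lt hqp))
    have h := exists_mem_associatedPrimes_localCohomology_iff I hIp hrs havoid
    rw [hlen] at h
    refine h.trans (exists_congr fun j => and_congr_right fun hj => ?_)
    rw [List.take_take, min_eq_left hj, ofList_take_ofFn]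
  ext p
  simp only [Set.mem_iUnion, Set.mem_inter_iff, Set.mem_ofPred_eq, exists_prop]
  constructor
  · rintro ⟨j, hj, hp, hpk⟩
    have hIp := le_of_mem_associatedPrimes_localCohomology I hp
    obtain ⟨i, hi, hpi⟩ := (hiff hp.isPrime hpk hIp).1 ⟨j, hj, hp⟩
    exact ⟨i, hi, ⟨hpi, hpk⟩, hIp⟩
  · rintro ⟨j, hj, ⟨hp, hpk⟩, hIp⟩
    obtain ⟨i, hi, hpi⟩ := (hiff hp.isPrime hpk hIp).2 ⟨j, hj, hp⟩
    exact ⟨i, hi, hpi, hpk⟩
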